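/- arXiv:2603.17422 — 2 statements merged into one kernel-verified Lean document; each statement's English description precedes it below -/
import Mathlib

section
/- Let (X_n) be a time-inhomogeneous Markov chain on a Polish space 𝒳 with one-step kernels (K_n)_{n∈ℤ} satisfying the Drift Condition with function V and constants γ∈(0,1), C>0, and set C' := C/(1−γ). Fix R > C'/(1−γ), set ρ := γ + C'/R < 1 and C(R) := {x : V(x) ≤ R}. For a starting time s and starting state x, let τ := inf{ k ≥ 0 : X_{s+k} ∈ C(R) }. Then for every n ≥ 0, 𝔼_{s,x}[ V(X_{s+n})·1{τ > n} ] ≤ ρⁿ·V(x). -/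
open MeasureTheory ProbabilityTheory Filter
open scoped ENNReal NNReal

noncomputable section

/-- The σ-algebra generated by `X 0, …, X n` (the past of the process up to time `n`). -/
def pastSA {Ω S : Type*} [MeasurableSpace S] (X : ℕ → Ω → S) (n : ℕ) :
    MeasurableSpace Ω :=
  ⨆ i : Fin (n + 1), MeasurableSpace.comap (X i) inferInstance

/-- `X` is a time-inhomogeneous Markov chain started at time `s`, where `X n`
stands for the state at absolute time `s + n`:
`Pr(X_{n+1} ∈ A ∣ X_0,…,X_n) = K_{s+n+1}(X_n, A)` a.s. -/
def IsInhomMarkovFrom {Ω S : Type*} [MeasurableSpace Ω] [MeasurableSpace S]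
    (Pr : Measure Ω) (s : ℤ) (X : ℕ → Ω → S) (K : ℤ → S → Measure S) : Prop :=
  (∀ n, Measurable (X n)) ∧
  ∀ (n : ℕ) (A : Set S), MeasurableSet A → ∀ B : Set Ω, MeasurableSet[pastSA X n] B →
    Pr (B ∩ X (n + 1) ⁻¹' A) = ∫⁻ ω in B, K (s + n + 1) (X n ω) A ∂Pr

lemma measurable_pastSA {Ω S : Type*} [MeasurableSpace S] (X : ℕ → Ω → S) {k n : ℕ} (hk : k ≤ n) :
    Measurable[pastSA X n] (X k) := by
  have h : MeasurableSpace.comap (X k) inferInstance ≤ pastSA X n :=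
    le_iSup (fun i : Fin (n + 1) => MeasurableSpace.comap (X i) inferInstance)
      ⟨k, Nat.lt_succ_of_le hk⟩
  exact measurable_iff_comap_le.mpr h

lemma pastSA_le {Ω S : Type*} [MeasurableSpace Ω] [MeasurableSpace S] {X : ℕ → Ω → S}
    (hX : ∀ n, Measurable (X n)) (n : ℕ) : pastSA X n ≤ ‹MeasurableSpace Ω› :=
  iSup_le fun i => (hX i).comap_le

lemma measurableSet_forall_le_lt {Ω S : Type*} [MeasurableSpace S] (X : ℕ → Ω → S)
    {V : S → ℝ≥0∞} (hV : Measurable V) (R : ℝ≥0∞) (n : ℕ) :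
    MeasurableSet[pastSA X n] {ω | ∀ k ≤ n, R < V (X k ω)} := by
  simp only [Set.ofPred_forall]
  refine MeasurableSet.iInter fun k => MeasurableSet.iInter fun hk => ?_
  exact measurable_pastSA X hk (measurableSet_lt measurable_const hV)

/-- One-step disintegration of a Markov chain on an event of the past. -/
lemma IsInhomMarkovFrom.setLIntegral_succ {Ω S : Type*} [MeasurableSpace Ω] [MeasurableSpace S]
    {Pr : Measure Ω} {s : ℤ} {X : ℕ → Ω → S} {K : ℤ → Kernel S S}
    (hX : IsInhomMarkovFrom Pr s X (fun k => ⇑(K k))) {f : S → ℝ≥0∞} (hf : Measurable f)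
    {n : ℕ} {B : Set Ω} (hB : MeasurableSet[pastSA X n] B) :
    ∫⁻ ω in B, f (X (n + 1) ω) ∂Pr = ∫⁻ ω in B, ∫⁻ y, f y ∂(K (s + n + 1) (X n ω)) ∂Pr := by
  have hlaw : (Pr.restrict B).map (X (n + 1))
      = ((Pr.restrict B).map (X n)).bind (K (s + n + 1)) := by
    ext A hA
    rw [Measure.map_apply (hX.1 _) hA, Measure.restrict_apply (hX.1 _ hA), Set.inter_comm,
      hX.2 n A hA B hB, Measure.bind_apply hA (K (s + n + 1)).aemeasurable,
      lintegral_map ((K (s + n + 1)).measurable_coe hA) (hX.1 n)]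
  rw [← lintegral_map hf (hX.1 (n + 1)), hlaw,
    Measure.lintegral_bind (K (s + n + 1)).aemeasurable hf.aemeasurable,
    lintegral_map hf.lintegral_kernel (hX.1 n)]

lemma affine_le_mul_of_lt {γ C R v : ℝ≥0∞} (hR0 : R ≠ 0) (hv : R < v) :
    γ * v + C ≤ (γ + C / (1 - γ) / R) * v := by
  rw [add_mul]
  gcongr
  calc C ≤ C / (1 - γ) := by
        simpa using ENNReal.div_le_div_left (tsub_le_self : 1 - γ ≤ 1) C
    _ = C / (1 - γ) / R * R := (ENNReal.div_mul_cancel hR0 hv.ne_top).symm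
    _ ≤ C / (1 - γ) / R * v := by gcongr

/-- **Drift estimate before the return time.**
Under the Drift Condition, with `C' = C/(1−γ)`, `R > C'/(1−γ)`, `ρ = γ + C'/R < 1`,
and `τ = inf {k ≥ 0 : V(X_{s+k}) ≤ R}`, one has
`𝔼_{s,x}[V(X_{s+n})·1{τ > n}] ≤ ρⁿ·V(x)` for every `n ≥ 0`. -/
theorem drift_estimate_before_return
    {𝒳 : Type*} [MeasurableSpace 𝒳] [TopologicalSpace 𝒳] [PolishSpace 𝒳] [BorelSpace 𝒳]
    {Ω : Type*} [MeasurableSpace Ω] (Pr : Measure Ω) [IsProbabilityMeasure Pr]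
    -- the one-step Markov kernels
    (K : ℤ → Kernel 𝒳 𝒳) (hK : ∀ n, IsMarkovKernel (K n))
    -- Drift Condition
    (V : 𝒳 → ℝ≥0∞) (hV : Measurable V) (hVne : ∃ x, V x < ⊤)
    (γ C : ℝ≥0∞) (hγ0 : 0 < γ) (hγ1 : γ < 1) (hC0 : 0 < C) (hCtop : C < ⊤)
    (hdrift : ∀ (n : ℤ) (x : 𝒳), ∫⁻ y, V y ∂(K n x) ≤ γ * V x + C)
    -- the level `R`, with `C' := C/(1−γ)` and `R > C'/(1−γ)`
    (R : ℝ≥0∞) (hR : C / (1 - γ) / (1 - γ) < R)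
    -- the chain, started at time `s` from the state `x`
    (s : ℤ) (x : 𝒳) (X : ℕ → Ω → 𝒳)
    (hX : IsInhomMarkovFrom Pr s X (fun k => ⇑(K k)))
    (hX0 : ∀ᵐ ω ∂Pr, X 0 ω = x) :
    ∀ n : ℕ, ∫⁻ ω in {ω | ∀ k ≤ n, R < V (X k ω)}, V (X n ω) ∂Pr
        ≤ (γ + (C / (1 - γ)) / R) ^ n * V x := by
  intro n
  induction n with
  | zero =>
    calc ∫⁻ ω in {ω | ∀ k ≤ 0, R < V (X k ω)}, V (X 0 ω) ∂Pr
        ≤ ∫⁻ ω, V (X 0 ω) ∂Pr := setLIntegral_le_lintegral _ _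
      _ = ∫⁻ _, V x ∂Pr := lintegral_congr_ae (hX0.mono fun ω h => by simp only [h])
      _ = (γ + (C / (1 - γ)) / R) ^ 0 * V x := by simp
  | succ n ih =>
    have hE := measurableSet_forall_le_lt X hV R n
    calc ∫⁻ ω in {ω | ∀ k ≤ n + 1, R < V (X k ω)}, V (X (n + 1) ω) ∂Pr
        ≤ ∫⁻ ω in {ω | ∀ k ≤ n, R < V (X k ω)}, V (X (n + 1) ω) ∂Pr :=
          lintegral_mono_set fun ω h k hk => h k (hk.trans n.le_succ)
      _ = ∫⁻ ω in {ω | ∀ k ≤ n, R < V (X k ω)}, ∫⁻ y, V y ∂(K (s + n + 1) (X n ω)) ∂Pr :=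
          hX.setLIntegral_succ hV hE
      _ ≤ ∫⁻ ω in {ω | ∀ k ≤ n, R < V (X k ω)}, (γ + (C / (1 - γ)) / R) * V (X n ω) ∂Pr :=
          setLIntegral_mono' (pastSA_le hX.1 n _ hE) fun ω h =>
            (hdrift _ _).trans (affine_le_mul_of_lt (bot_lt_of_lt hR).ne' (h n le_rfl))
      _ = (γ + (C / (1 - γ)) / R) * ∫⁻ ω in {ω | ∀ k ≤ n, R < V (X k ω)}, V (X n ω) ∂Pr :=
          lintegral_const_mul _ (hV.comp (hX.1 n))
      _ ≤ (γ + (C / (1 - γ)) / R) * ((γ + (C / (1 - γ)) / R) ^ n * V x) := by gcongr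
      _ = (γ + (C / (1 - γ)) / R) ^ (n + 1) * V x := by rw [pow_succ', mul_assoc]


end
end

section
/- Let (K_n)_{n∈ℤ} be Markov kernels on a Polish space 𝒳, β∈(0,1), ν a probability measure, and C ⊆ 𝒳 a Borel set with K_n(x,·) ≥ βν(·) for all n and x∈C. Let Ǩ_n denote the corresponding split kernels on 𝒳×{0,1}: Ǩ_n((x,0),·) = (K_n(x,·))* if x∉C, Ǩ_n((x,0),·) = ((K_n(x,·)−βν)/(1−β))* if x∈C, Ǩ_n((x,1),·) = ν*. Let λ be a probability measure on 𝒳, let (X_n)_{n≥0} be the time-inhomogeneous Markov chain with kernels (K_n) and initial law λ, and let (X̌_n)_{n≥0} = (X'_n, δ_n) be the time-inhomogeneous Markov chain on 𝒳×{0,1} with kernels (Ǩ_n) and initial law λ*. Then the marginal process (X'_n)_{n≥0} is identical in law to (X_n)_{n≥0}: for every n≥1 and all Borel sets E₁,…,E_n ⊆ 𝒳, ℙ(X'_1∈E₁,…,X'_n∈E_n) = ℙ(X_1∈E₁,…,X_n∈E_n). -/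
open MeasureTheory ProbabilityTheory Filter
open scoped ENNReal

noncomputable section

attribute [local instance] Classical.propDecidable

/-- `X` is a time-inhomogeneous Markov chain under `Pr` with one-step transition law
`Q n` from time `n` to time `n + 1`, i.e. `Pr(X_{n+1} ∈ A ∣ X_0,…,X_n) = Q n (X n) A` a.s. -/
def IsInhomMarkov {Ω S : Type*} [MeasurableSpace Ω] [MeasurableSpace S]
    (Pr : Measure Ω) (X : ℕ → Ω → S) (Q : ℕ → S → Measure S) : Prop :=
  (∀ n, Measurable (X n)) ∧
  ∀ (n : ℕ) (A : Set S), MeasurableSet A → ∀ B : Set Ω, MeasurableSet[pastSA X n] B →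
    Pr (B ∩ X (n + 1) ⁻¹' A) = ∫⁻ ω in B, Q n (X n ω) A ∂Pr

/-- The splitting `μ*` of a (sub)probability measure `μ` on `𝒳`, as a measure on
`𝒳 × {0,1}` (with `Bool`, `false ↔ 0`, `true ↔ 1`):
`μ*(A×{0}) = (1−β)μ(A∩C) + μ(A∩Cᶜ)` and `μ*(A×{1}) = βμ(A∩C)`. -/
def splitMeasure {𝒳 : Type*} [MeasurableSpace 𝒳] (β : ℝ≥0∞) (C : Set 𝒳)
    (μ : Measure 𝒳) : Measure (𝒳 × Bool) :=
  Measure.map (fun x => (x, false)) ((1 - β) • μ.restrict C + μ.restrict Cᶜ)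
    + Measure.map (fun x => (x, true)) (β • μ.restrict C)

/-- The split kernel `Ǩ` on `𝒳 × {0,1}`: `Ǩ((x,0),·) = (K(x,·))*` if `x ∉ C`,
`Ǩ((x,0),·) = ((K(x,·) − βν)/(1−β))*` if `x ∈ C`, and `Ǩ((x,1),·) = ν*`. -/
def splitKernel {𝒳 : Type*} [MeasurableSpace 𝒳] (K : Kernel 𝒳 𝒳) (β : ℝ≥0∞)
    (ν : Measure 𝒳) (C : Set 𝒳) : 𝒳 × Bool → Measure (𝒳 × Bool) :=
  fun p =>
    if p.2 = true then splitMeasure β C ν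
    else if p.1 ∈ C then splitMeasure β C ((1 - β)⁻¹ • (K p.1 - β • ν))
    else splitMeasure β C (K p.1)

section SplitMeasure

variable {𝒳 : Type*} [MeasurableSpace 𝒳]

theorem splitMeasure_apply (β : ℝ≥0∞) (C : Set 𝒳) (μ : Measure 𝒳)
    {A : Set (𝒳 × Bool)} (hA : MeasurableSet A) :
    splitMeasure β C μ A = (1 - β) * μ ((fun x => (x, false)) ⁻¹' A ∩ C)
      + μ ((fun x => (x, false)) ⁻¹' A ∩ Cᶜ) + β * μ ((fun x => (x, true)) ⁻¹' A ∩ C) := by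
  have h0 : Measurable (fun x : 𝒳 => (x, false)) := measurable_prodMk_right
  have h1 : Measurable (fun x : 𝒳 => (x, true)) := measurable_prodMk_right
  simp [splitMeasure, Measure.map_apply h0 hA, Measure.map_apply h1 hA,
    Measure.restrict_apply (h0 hA), Measure.restrict_apply (h1 hA)]

theorem splitMeasure_univ {β : ℝ≥0∞} (hβ : β ≤ 1) {C : Set 𝒳} (hC : MeasurableSet C)
    (μ : Measure 𝒳) : splitMeasure β C μ Set.univ = μ Set.univ := by
  rw [splitMeasure_apply β C μ MeasurableSet.univ, add_right_comm]
  simp only [Set.preimage_univ, Set.univ_inter]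
  rw [← add_mul, tsub_add_cancel_of_le hβ, one_mul, measure_add_measure_compl hC]

theorem splitMeasure_add (β : ℝ≥0∞) (C : Set 𝒳) (μ ν : Measure 𝒳) :
    splitMeasure β C (μ + ν) = splitMeasure β C μ + splitMeasure β C ν := by
  have h0 : Measurable (fun x : 𝒳 => (x, false)) := measurable_prodMk_right
  have h1 : Measurable (fun x : 𝒳 => (x, true)) := measurable_prodMk_right
  simp only [splitMeasure, Measure.restrict_add, smul_add, Measure.map_add _ _ h0,
    Measure.map_add _ _ h1]
  abel

theorem splitMeasure_smul (β c : ℝ≥0∞) (C : Set 𝒳) (μ : Measure 𝒳) :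
    splitMeasure β C (c • μ) = c • splitMeasure β C μ := by
  simp only [splitMeasure, Measure.restrict_smul, smul_add, smul_comm _ c, ← Measure.map_smul]

theorem splitMeasure_restrict (β : ℝ≥0∞) {C : Set 𝒳} (hC : MeasurableSet C) (μ : Measure 𝒳)
    {E : Set 𝒳} (hE : MeasurableSet E) :
    splitMeasure β C (μ.restrict E) = (splitMeasure β C μ).restrict (Prod.fst ⁻¹' E) := by
  have h0 : Measurable (fun x : 𝒳 => (x, false)) := measurable_prodMk_right
  have h1 : Measurable (fun x : 𝒳 => (x, true)) := measurable_prodMk_right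
  ext A hA
  rw [Measure.restrict_apply hA, splitMeasure_apply β C _ hA,
    splitMeasure_apply β C _ (hA.inter (measurable_fst hE)),
    Measure.restrict_apply ((h0 hA).inter hC), Measure.restrict_apply ((h0 hA).inter hC.compl),
    Measure.restrict_apply ((h1 hA).inter hC)]
  simp only [Set.preimage_inter, ← Set.preimage_comp, Function.comp_def, Set.preimage_id',
    Set.inter_right_comm]

theorem lintegral_splitMeasure (β : ℝ≥0∞) (C : Set 𝒳) (μ : Measure 𝒳)
    {q : 𝒳 × Bool → ℝ≥0∞} (hq : Measurable q) :
    ∫⁻ p, q p ∂(splitMeasure β C μ) = ∫⁻ x in C, (1 - β) * q (x, false) + β * q (x, true) ∂μ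
      + ∫⁻ x in Cᶜ, q (x, false) ∂μ := by
  have h0 : Measurable (fun x : 𝒳 => (x, false)) := measurable_prodMk_right
  have h1 : Measurable (fun x : 𝒳 => (x, true)) := measurable_prodMk_right
  rw [splitMeasure, lintegral_add_measure, lintegral_map hq h0, lintegral_map hq h1,
    lintegral_add_measure, lintegral_smul_measure, lintegral_smul_measure,
    lintegral_add_left (f := fun x => (1 - β) * q (x, false)) ((hq.comp h0).const_mul _),
    lintegral_const_mul (f := fun x => q (x, false)) _ (hq.comp h0),
    lintegral_const_mul (f := fun x => q (x, true)) _ (hq.comp h1), smul_eq_mul, smul_eq_mul, add_right_comm]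

theorem lintegral_splitMeasure_kernel (β : ℝ≥0∞) {C : Set 𝒳} (hC : MeasurableSet C)
    (K : Kernel 𝒳 𝒳) (μ : Measure 𝒳) {A : Set (𝒳 × Bool)} (hA : MeasurableSet A) :
    ∫⁻ x, splitMeasure β C (K x) A ∂μ = splitMeasure β C (μ.bind K) A := by
  have h0 : MeasurableSet ((fun x : 𝒳 => (x, false)) ⁻¹' A) := measurable_prodMk_right hA
  have h1 : MeasurableSet ((fun x : 𝒳 => (x, true)) ⁻¹' A) := measurable_prodMk_right hA
  simp only [splitMeasure_apply β C _ hA]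
  have m0 := K.measurable_coe (h0.inter hC)
  have m1 := K.measurable_coe (h0.inter hC.compl)
  have m2 := K.measurable_coe (h1.inter hC)
  rw [lintegral_add_right _ (m2.const_mul _), lintegral_add_left (m0.const_mul _),
    lintegral_const_mul _ m0, lintegral_const_mul _ m2,
    Measure.bind_apply (h0.inter hC) K.aemeasurable,
    Measure.bind_apply (h0.inter hC.compl) K.aemeasurable,
    Measure.bind_apply (h1.inter hC) K.aemeasurable]

end SplitMeasure

section SplitKernel

variable {𝒳 : Type*} [MeasurableSpace 𝒳] {K : Kernel 𝒳 𝒳} {β : ℝ≥0∞} {ν : Measure 𝒳} {C : Set 𝒳}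

theorem measurable_splitKernel_apply [IsFiniteMeasure ν] (hβ : β ≤ 1) (hC : MeasurableSet C)
    (hmin : ∀ x ∈ C, β • ν ≤ K x) {A : Set (𝒳 × Bool)} (hA : MeasurableSet A) :
    Measurable fun p => splitKernel K β ν C p A := by
  have : IsFiniteMeasure (β • ν) := ν.smul_finite (hβ.trans_lt ENNReal.one_lt_top).ne
  have h0 : MeasurableSet ((fun x : 𝒳 => (x, false)) ⁻¹' A) := measurable_prodMk_right hA
  have h1 : MeasurableSet ((fun x : 𝒳 => (x, true)) ⁻¹' A) := measurable_prodMk_right hA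
  have hf {S : Set 𝒳} (hS : MeasurableSet S) : Measurable fun p : 𝒳 × Bool => K p.1 S :=
    (K.measurable_coe hS).comp measurable_fst
  have hg {S : Set 𝒳} (hS : MeasurableSet S) :
      Measurable fun p : 𝒳 × Bool => (1 - β)⁻¹ * (K p.1 S - (β • ν) S) :=
    ((hf hS).sub_const _).const_mul _
  let residual : 𝒳 × Bool → ℝ≥0∞ := fun p =>
    (1 - β) * ((1 - β)⁻¹ * (K p.1 ((fun x => (x, false)) ⁻¹' A ∩ C)
        - (β • ν) ((fun x => (x, false)) ⁻¹' A ∩ C)))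
      + (1 - β)⁻¹ * (K p.1 ((fun x => (x, false)) ⁻¹' A ∩ Cᶜ)
        - (β • ν) ((fun x => (x, false)) ⁻¹' A ∩ Cᶜ))
      + β * ((1 - β)⁻¹ * (K p.1 ((fun x => (x, true)) ⁻¹' A ∩ C)
        - (β • ν) ((fun x => (x, true)) ⁻¹' A ∩ C)))
  have hres : Measurable residual :=
    (((hg (h0.inter hC)).const_mul _).add (hg (h0.inter hC.compl))).add
      ((hg (h1.inter hC)).const_mul _)
  have hout : Measurable fun p : 𝒳 × Bool => splitMeasure β C (K p.1) A := by
    simp only [splitMeasure_apply β C _ hA]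
    exact (((hf (h0.inter hC)).const_mul _).add (hf (h0.inter hC.compl))).add
      ((hf (h1.inter hC)).const_mul _)
  have key : (fun p => splitKernel K β ν C p A) = fun p =>
      if p.2 = true then splitMeasure β C ν A
      else if p.1 ∈ C then residual p else splitMeasure β C (K p.1) A := by
    funext p
    unfold splitKernel
    split_ifs with hp hpC
    · rfl
    · have hle := hmin p.1 hpC
      rw [splitMeasure_apply β C _ hA]
      simp only [Measure.smul_apply, smul_eq_mul, residual]
      rw [Measure.sub_apply (h0.inter hC) hle, Measure.sub_apply (h0.inter hC.compl) hle,
        Measure.sub_apply (h1.inter hC) hle]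
      simp only [Measure.smul_apply, smul_eq_mul]
    · rfl
  rw [key]
  exact Measurable.ite (measurable_snd (measurableSet_singleton true)) measurable_const
    (Measurable.ite (measurable_fst hC) hres hout)

theorem splitKernel_mix [IsFiniteMeasure ν] (hβ : β < 1) (hmin : ∀ x ∈ C, β • ν ≤ K x)
    {x : 𝒳} (hx : x ∈ C) :
    (1 - β) • splitKernel K β ν C (x, false) + β • splitKernel K β ν C (x, true)
      = splitMeasure β C (K x) := by
  have : IsFiniteMeasure (β • ν) := ν.smul_finite (hβ.trans ENNReal.one_lt_top).ne
  have h : (1 - β) * (1 - β)⁻¹ = 1 :=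
    ENNReal.mul_inv_cancel (tsub_pos_of_lt hβ).ne' (ENNReal.sub_ne_top ENNReal.one_ne_top)
  simp only [splitKernel, hx, if_true, Bool.false_eq_true, if_false]
  rw [splitMeasure_smul, smul_smul, h, one_smul, ← splitMeasure_smul, ← splitMeasure_add,
    Measure.sub_add_cancel_of_le (hmin x hx)]

theorem lintegral_splitKernel_splitMeasure [IsFiniteMeasure ν] (hβ : β < 1)
    (hC : MeasurableSet C) (hmin : ∀ x ∈ C, β • ν ≤ K x) (μ : Measure 𝒳)
    {A : Set (𝒳 × Bool)} (hA : MeasurableSet A) :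
    ∫⁻ p, splitKernel K β ν C p A ∂(splitMeasure β C μ) = splitMeasure β C (μ.bind K) A := by
  rw [lintegral_splitMeasure β C μ (measurable_splitKernel_apply hβ.le hC hmin hA),
    ← lintegral_splitMeasure_kernel β hC K μ hA, ← lintegral_add_compl (μ := μ) _ hC]
  congr 1
  · refine setLIntegral_congr_fun hC fun x hx => ?_
    rw [← splitKernel_mix hβ hmin hx]
    simp
  · refine setLIntegral_congr_fun hC.compl fun x hx => ?_
    simp [splitKernel, (show x ∉ C from hx)]

end SplitKernel

section InhomMarkov

variable {Ω S : Type*} [MeasurableSpace S] {X : ℕ → Ω → S}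

theorem measurableSet_pastSA_preimage {k n : ℕ} (hk : k ≤ n) {A : Set S} (hA : MeasurableSet A) :
    MeasurableSet[pastSA X n] (X k ⁻¹' A) :=
  le_iSup (fun i : Fin (n + 1) => MeasurableSpace.comap (X i) inferInstance)
    ⟨k, Nat.lt_succ_of_le hk⟩ _ ⟨A, hA, rfl⟩

theorem measurableSet_pastSA_biInter (n : ℕ) {E : ℕ → Set S} (hE : ∀ k, MeasurableSet (E k)) :
    MeasurableSet[pastSA X n] (⋂ k ∈ Finset.Icc 1 n, X k ⁻¹' E k) :=
  Finset.measurableSet_biInter _ fun k hk =>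
    measurableSet_pastSA_preimage (Finset.mem_Icc.1 hk).2 (hE k)

theorem biInter_Icc_one_succ (E : ℕ → Set Ω) (n : ℕ) :
    ⋂ k ∈ Finset.Icc 1 (n + 1), E k = E (n + 1) ∩ ⋂ k ∈ Finset.Icc 1 n, E k := by
  rw [← Finset.insert_Icc_right_eq_Icc_add_one (by lia), Finset.set_biInter_insert]

variable [MeasurableSpace Ω] {Pr : Measure Ω} {Q : ℕ → S → Measure S}

theorem IsInhomMarkov.map_restrict_succ_apply (hX : IsInhomMarkov Pr X Q) {n : ℕ} {A : Set S}
    (hA : MeasurableSet A) (hQ : Measurable fun x => Q n x A) {B : Set Ω}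
    (hB : MeasurableSet[pastSA X n] B) :
    (Pr.restrict B).map (X (n + 1)) A = ∫⁻ x, Q n x A ∂((Pr.restrict B).map (X n)) := by
  rw [Measure.map_apply (hX.1 _) hA, Measure.restrict_apply (hX.1 _ hA), Set.inter_comm,
    hX.2 n A hA B hB, lintegral_map hQ (hX.1 n)]

end InhomMarkov

/-- **The marginal of the split chain is the original chain:**  if `X` is a chain
with kernels `(K_n)` and initial law `μ₀`, and `Y = (X', δ)` is a chain on
`𝒳 × {0,1}` with the split kernels `(Ǩ_n)` and initial law `μ₀*`, then the first
marginal `X'` of the split chain has the same finite-dimensional laws as `X`. -/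
theorem split_chain_marginal_law
    {𝒳 : Type*} [MeasurableSpace 𝒳] [TopologicalSpace 𝒳] [PolishSpace 𝒳] [BorelSpace 𝒳]
    {Ω Ω' : Type*} [MeasurableSpace Ω] [MeasurableSpace Ω']
    (Pr : Measure Ω) [IsProbabilityMeasure Pr]
    (Pr' : Measure Ω') [IsProbabilityMeasure Pr']
    (K : ℤ → Kernel 𝒳 𝒳) (hK : ∀ n, IsMarkovKernel (K n))
    (β : ℝ≥0∞) (hβ0 : 0 < β) (hβ1 : β < 1)
    (ν : Measure 𝒳) (hν : IsProbabilityMeasure ν)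
    (C : Set 𝒳) (hC : MeasurableSet C)
    (hmin : ∀ (n : ℤ), ∀ x ∈ C, ∀ A : Set 𝒳, MeasurableSet A → β * ν A ≤ K n x A)
    (μ₀ : Measure 𝒳) (hμ₀ : IsProbabilityMeasure μ₀)
    -- the original chain
    (X : ℕ → Ω → 𝒳)
    (hX : IsInhomMarkov Pr X (fun n x => K ((n : ℤ) + 1) x))
    (hX0 : Measure.map (X 0) Pr = μ₀)
    -- the split chain
    (Y : ℕ → Ω' → 𝒳 × Bool)
    (hY : IsInhomMarkov Pr' Y (fun n p => splitKernel (K ((n : ℤ) + 1)) β ν C p))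
    (hY0 : Measure.map (Y 0) Pr' = splitMeasure β C μ₀) :
    ∀ n : ℕ, 1 ≤ n → ∀ E : ℕ → Set 𝒳, (∀ k, MeasurableSet (E k)) →
      Pr' (⋂ k ∈ Finset.Icc 1 n, (fun ω => (Y k ω).1) ⁻¹' E k)
        = Pr (⋂ k ∈ Finset.Icc 1 n, X k ⁻¹' E k) := by
  have : IsProbabilityMeasure ν := hν
  have hminle : ∀ (n : ℤ), ∀ x ∈ C, β • ν ≤ K n x := fun n x hx =>
    Measure.le_iff.2 fun A hA => by simpa using hmin n x hx A hA
  intro n _ E hE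
  change Pr' (⋂ k ∈ Finset.Icc 1 n, Y k ⁻¹' (Prod.fst ⁻¹' E k)) = _
  have hEY : ∀ k, MeasurableSet (Prod.fst ⁻¹' E k : Set (𝒳 × Bool)) :=
    fun k => measurable_fst (hE k)
  have law : (Pr'.restrict (⋂ k ∈ Finset.Icc 1 n, Y k ⁻¹' (Prod.fst ⁻¹' E k))).map (Y n)
      = splitMeasure β C ((Pr.restrict (⋂ k ∈ Finset.Icc 1 n, X k ⁻¹' E k)).map (X n)) := by
    clear * - hβ1 hν hC hminle hX hX0 hY hY0 hE hEY
    induction n with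
    | zero => simp [hX0, hY0]
    | succ n ih =>
      have hXlaw : (Pr.restrict (⋂ k ∈ Finset.Icc 1 n, X k ⁻¹' E k)).map (X (n + 1))
          = ((Pr.restrict (⋂ k ∈ Finset.Icc 1 n, X k ⁻¹' E k)).map (X n)).bind
              (K ((n : ℤ) + 1)) := by
        ext A hA
        rw [hX.map_restrict_succ_apply hA ((K _).measurable_coe hA)
          (measurableSet_pastSA_biInter n hE), Measure.bind_apply hA (K _).aemeasurable]
      have hYlaw :
          (Pr'.restrict (⋂ k ∈ Finset.Icc 1 n, Y k ⁻¹' (Prod.fst ⁻¹' E k))).map (Y (n + 1))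
          = splitMeasure β C
              ((Pr.restrict (⋂ k ∈ Finset.Icc 1 n, X k ⁻¹' E k)).map (X (n + 1))) := by
        ext A hA
        rw [hY.map_restrict_succ_apply hA
          (measurable_splitKernel_apply hβ1.le hC (hminle _) hA)
          (measurableSet_pastSA_biInter n hEY), ih, hXlaw,
          lintegral_splitKernel_splitMeasure hβ1 hC (hminle _) _ hA]
      rw [biInter_Icc_one_succ, biInter_Icc_one_succ,
        ← Measure.restrict_restrict (hX.1 _ (hE _)),
        ← Measure.restrict_restrict (hY.1 _ (hEY _)),
        ← Measure.restrict_map (hX.1 _) (hE _), splitMeasure_restrict β hC _ (hE _), ← hYlaw,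
        Measure.restrict_map (hY.1 _) (hEY _)]
  have total := congrArg (fun μ => μ Set.univ) law
  simpa [splitMeasure_univ hβ1.le hC, Measure.map_apply (hX.1 n) MeasurableSet.univ,
    Measure.map_apply (hY.1 n) MeasurableSet.univ] using total

end
end
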